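/- arXiv:2407.10843 — 3 statements merged into one kernel-verified Lean document; each statement's English description precedes it below -/
import Mathlib

section
/- Let f(z) = z₀²/(z₀² + z²) with z₀ > 0. There exists a C¹ function z : [0,T] → ℝ satisfying z'(t) = F_z(t, z(t)) for all t ∈ [0,T] and z(0) = z(T); consequently, by T-periodic extension, the equation z' = F_z(t,z) has a T-periodic solution defined on all of ℝ. -/
open Filter Set

/-- The force `F_z(t,z) = −k F₀ f(z) sin(2kz − bt) + F₀ cos²(kz − bt/2) f'(z)`. -/
noncomputable def Fz (F₀ k b : ℝ) (f : ℝ → ℝ) (t z : ℝ) : ℝ :=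
  -k * F₀ * f z * Real.sin (2 * k * z - b * t)
    + F₀ * (Real.cos (k * z - b * t / 2)) ^ 2 * deriv f z

/-- The periodic extension of a function on `[0, T]` with equal end values that solves a
`T`-periodic differential equation solves it on all of `ℝ`. -/
theorem exists_periodic_hasDerivAt_of_Icc {v : ℝ → ℝ → ℝ} {T : ℝ} (hT : 0 < T)
    (hper : ∀ t x, v (t + T) x = v t x) {z : ℝ → ℝ}
    (hz : ∀ t ∈ Icc 0 T, HasDerivWithinAt z (v t (z t)) (Icc 0 T) t) (hzT : z 0 = z T) :
    ∃ w : ℝ → ℝ, (∀ t, w (t + T) = w t) ∧ ∀ t, HasDerivAt w (v t (w t)) t := by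
  have hv : ∀ (n : ℤ) t x, v (t - n * T) x = v t x := fun n t x =>
    Function.Periodic.sub_int_mul_eq (f := fun t => v t x) (fun t => hper t x) n
  let w : ℝ → ℝ := fun t => z (T * Int.fract (t / T))
  have hw : ∀ (n : ℤ), ∀ t ∈ Icc (n * T) ((n + 1) * T), w t = z (t - n * T) := by
    intro n t ht
    rcases eq_or_lt_of_le ht.2 with h | h
    · have h1 : t / T = ((n + 1 : ℤ) : ℝ) := by push_cast; rw [h]; field_simp
      have h2 : t - n * T = T := by rw [h]; ring
      simp only [w, h1, Int.fract_intCast, mul_zero, h2, hzT]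
    · have h1 : ⌊t / T⌋ = n := by
        rw [Int.floor_eq_iff, le_div_iff₀ hT, div_lt_iff₀ hT]
        exact ⟨ht.1, h⟩
      simp only [w, Int.fract, h1]
      congr 1
      field_simp
  have hd : ∀ (n : ℤ), ∀ t ∈ Icc (n * T) ((n + 1) * T),
      HasDerivWithinAt w (v t (w t)) (Icc (n * T) ((n + 1) * T)) t := by
    intro n t ht
    have hmaps : MapsTo (fun s => s - n * T) (Icc (n * T) ((n + 1) * T)) (Icc 0 T) := by
      intro s hs
      constructor <;> linarith [hs.1, hs.2]
    have h1 := hz (t - n * T) (hmaps ht)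
    have h2 : HasDerivWithinAt (fun s => s - n * T) 1 (Icc (n * T) ((n + 1) * T)) t :=
      (hasDerivWithinAt_id t _).sub_const _
    have h3 := HasDerivWithinAt.comp t h1 h2 hmaps
    rw [hv, mul_one, ← hw n t ht] at h3
    exact h3.congr (fun s hs => hw n s hs) (hw n t ht)
  refine ⟨w, fun t => ?_, fun t => ?_⟩
  · have : (t + T) / T = t / T + 1 := by field_simp
    simp only [w, this, Int.fract_add_one]
  · have hn : (⌊t / T⌋ : ℝ) * T ≤ t := by
      rw [← le_div_iff₀ hT]; exact Int.floor_le _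
    have hn' : t < (⌊t / T⌋ + 1) * T := by
      rw [← div_lt_iff₀ hT]; exact Int.lt_floor_add_one _
    rcases eq_or_lt_of_le hn with h | h
    · have hr := hd ⌊t / T⌋ t ⟨hn, hn'.le⟩
      have hl := hd (⌊t / T⌋ - 1) t (by push_cast; constructor <;> linarith)
      refine (hl.union hr).hasDerivAt ?_
      push_cast
      rw [sub_add_cancel, h, Icc_union_Icc_eq_Icc (by linarith) hn'.le]
      exact Icc_mem_nhds (by linarith) hn'
    · exact (hd ⌊t / T⌋ t ⟨hn, hn'.le⟩).hasDerivAt (Icc_mem_nhds h hn')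

/-- A bounded Lipschitz time-dependent scalar field has a solution on `[0, T]` with equal end
values as soon as its time-`T` map moves `b` down and `a ≤ b` up. -/
theorem exists_eq_endpoints_of_lipschitz {v : ℝ → ℝ → ℝ} {T : ℝ} (hT : 0 < T) {K M : NNReal}
    (hcont : ∀ x, Continuous fun t => v t x) (hlip : ∀ t, LipschitzWith K (v t))
    (hbd : ∀ t x, |v t x| ≤ M) {a b : ℝ} (hab : a ≤ b)
    (hb : ∀ z : ℝ → ℝ, (∀ t ∈ Icc 0 T, HasDerivWithinAt z (v t (z t)) (Icc 0 T) t) →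
      z 0 = b → z T ≤ b)
    (ha : ∀ z : ℝ → ℝ, (∀ t ∈ Icc 0 T, HasDerivWithinAt z (v t (z t)) (Icc 0 T) t) →
      z 0 = a → a ≤ z T) :
    ∃ z : ℝ → ℝ, (∀ t ∈ Icc 0 T, HasDerivWithinAt z (v t (z t)) (Icc 0 T) t) ∧ z 0 = z T := by
  have hex : ∀ x : ℝ, ∃ z : ℝ → ℝ, z 0 = x ∧
      ∀ t ∈ Icc 0 T, HasDerivWithinAt z (v t (z t)) (Icc 0 T) t := by
    intro x
    have hpl : IsPicardLindelof v (tmin := 0) (tmax := T) ⟨0, le_rfl, hT.le⟩ x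
        (M * ⟨T, hT.le⟩) 0 M K :=
      { lipschitzOnWith := fun t _ => (hlip t).lipschitzOnWith
        continuousOn := fun x _ => (hcont x).continuousOn
        norm_le := fun t _ x _ => hbd t x
        mul_max_le := by
          rw [sub_zero, sub_zero, max_eq_left hT.le]
          exact (sub_zero _).ge }
    exact hpl.exists_eq_forall_mem_Icc_hasDerivWithinAt₀
  choose φ hφ0 hφ using hex
  have hφl : ∀ x y, dist (φ x T) (φ y T) ≤ dist x y * Real.exp (K * (T - 0)) := by
    intro x y
    have hder : ∀ x, ∀ t ∈ Ico 0 T, HasDerivWithinAt (φ x) (v t (φ x t)) (Ici t) t :=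
      fun x t ht => (hφ x t (Ico_subset_Icc_self ht)).mono_of_mem_nhdsWithin
        (Icc_mem_nhdsGE_of_mem ht)
    refine dist_le_of_trajectories_ODE hlip
      (fun t ht => (hφ x t ht).continuousWithinAt) (hder x)
      (fun t ht => (hφ y t ht).continuousWithinAt) (hder y) ?_ T ⟨hT.le, le_rfl⟩
    rw [hφ0, hφ0]
  have hφc : Continuous fun x => φ x T :=
    (LipschitzWith.of_dist_le_mul (K := ⟨Real.exp (K * (T - 0)), (Real.exp_pos _).le⟩)
      fun x y => (hφl x y).trans (mul_comm _ _).le).continuous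
  obtain ⟨x, -, hx⟩ := intermediate_value_Icc' hab (hφc.sub continuous_id).continuousOn
    (show (0 : ℝ) ∈ Icc (φ b T - b) (φ a T - a) from
      ⟨sub_nonpos.2 (hb _ (hφ b) (hφ0 b)), sub_nonneg.2 (ha _ (hφ a) (hφ0 a))⟩)
  exact ⟨φ x, hφ x, by rw [hφ0]; exact (sub_eq_zero.1 hx).symm⟩

section Lorentzian

variable {z₀ : ℝ}

/-- The Lorentzian profile. -/
noncomputable def lorentzian (z₀ w : ℝ) : ℝ := z₀ ^ 2 / (z₀ ^ 2 + w ^ 2)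

theorem lorentzian_pos (hz₀ : 0 < z₀) (w : ℝ) : 0 < lorentzian z₀ w := by
  unfold lorentzian; positivity

theorem lorentzian_le_one (hz₀ : 0 < z₀) (w : ℝ) : lorentzian z₀ w ≤ 1 := by
  unfold lorentzian
  rw [div_le_one (by positivity)]
  nlinarith [sq_nonneg w]

theorem lorentzian_le_four_mul (hz₀ : 0 < z₀) {w y : ℝ} (h : |y - w| ≤ |w| / 2) :
    lorentzian z₀ y ≤ 4 * lorentzian z₀ w := by
  have h1 : |w| ≤ 2 * |y| := by
    have := abs_sub_abs_le_abs_sub w y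
    rw [abs_sub_comm] at this
    linarith
  have h2 : w ^ 2 ≤ 4 * y ^ 2 := by
    rw [← sq_abs w, ← sq_abs y]; nlinarith [abs_nonneg w, abs_nonneg y]
  unfold lorentzian
  rw [← mul_div_assoc, div_le_div_iff₀ (by positivity) (by positivity)]
  nlinarith [sq_nonneg z₀, mul_nonneg (sq_nonneg z₀) (sub_nonneg.2 h2), sq_nonneg (z₀ * z₀)]

theorem hasDerivAt_lorentzian (hz₀ : 0 < z₀) (w : ℝ) :
    HasDerivAt (lorentzian z₀) (-(2 * w / z₀ ^ 2) * lorentzian z₀ w ^ 2) w := by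
  have h : HasDerivAt (fun w : ℝ => z₀ ^ 2 + w ^ 2) (2 * w) w := by
    simpa using (hasDerivAt_pow 2 w).const_add (z₀ ^ 2)
  have hne : z₀ ^ 2 + w ^ 2 ≠ 0 := by positivity
  refine ((hasDerivAt_const w (z₀ ^ 2)).div h hne).congr_deriv ?_
  unfold lorentzian
  field_simp
  ring

theorem deriv_lorentzian (hz₀ : 0 < z₀) :
    deriv (lorentzian z₀) = fun w => -(2 * w / z₀ ^ 2) * lorentzian z₀ w ^ 2 :=
  funext fun w => (hasDerivAt_lorentzian hz₀ w).deriv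

theorem abs_deriv_lorentzian_le (hz₀ : 0 < z₀) (w : ℝ) :
    |deriv (lorentzian z₀) w| ≤ lorentzian z₀ w / z₀ := by
  rw [deriv_lorentzian hz₀, abs_le]
  unfold lorentzian
  have hs : 0 < z₀ ^ 2 + w ^ 2 := by positivity
  constructor
  · rw [← sub_nonneg]
    have : -(2 * w / z₀ ^ 2) * (z₀ ^ 2 / (z₀ ^ 2 + w ^ 2)) ^ 2
        - -(z₀ ^ 2 / (z₀ ^ 2 + w ^ 2) / z₀) = z₀ * (z₀ - w) ^ 2 / (z₀ ^ 2 + w ^ 2) ^ 2 := by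
      field_simp
      ring
    rw [this]; positivity
  · rw [← sub_nonneg]
    have : z₀ ^ 2 / (z₀ ^ 2 + w ^ 2) / z₀ - -(2 * w / z₀ ^ 2) * (z₀ ^ 2 / (z₀ ^ 2 + w ^ 2)) ^ 2
        = z₀ * (z₀ + w) ^ 2 / (z₀ ^ 2 + w ^ 2) ^ 2 := by
      field_simp
      ring
    rw [this]; positivity

theorem hasDerivAt_deriv_lorentzian (hz₀ : 0 < z₀) (w : ℝ) :
    HasDerivAt (deriv (lorentzian z₀))
      (-(2 / z₀ ^ 2) * lorentzian z₀ w ^ 2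
        - 4 * w / z₀ ^ 2 * lorentzian z₀ w * deriv (lorentzian z₀) w) w := by
  have h1 : HasDerivAt (fun w : ℝ => -(2 * w / z₀ ^ 2)) (-(2 / z₀ ^ 2)) w := by
    exact (((hasDerivAt_id w).const_mul 2).div_const (z₀ ^ 2)).neg.congr_deriv (by ring)
  have h2 := (hasDerivAt_lorentzian hz₀ w).pow 2
  rw [deriv_lorentzian hz₀]
  refine (h1.mul h2).congr_deriv ?_
  rw [Pi.pow_apply]
  push_cast
  ring

theorem abs_second_deriv_lorentzian_le (hz₀ : 0 < z₀) (w : ℝ) :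
    |-(2 / z₀ ^ 2) * lorentzian z₀ w ^ 2
        - 4 * w / z₀ ^ 2 * lorentzian z₀ w * deriv (lorentzian z₀) w|
      ≤ 10 * lorentzian z₀ w / z₀ ^ 2 := by
  have hp := lorentzian_pos hz₀ w
  have h1 := lorentzian_le_one hz₀ w
  have hw : w ^ 2 / z₀ ^ 2 * lorentzian z₀ w ≤ 1 := by
    unfold lorentzian
    rw [div_mul_div_comm, div_le_one (by positivity)]
    nlinarith [sq_nonneg (z₀ * z₀)]
  have e : -(2 / z₀ ^ 2) * lorentzian z₀ w ^ 2
        - 4 * w / z₀ ^ 2 * lorentzian z₀ w * deriv (lorentzian z₀) w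
      = lorentzian z₀ w / z₀ ^ 2 * (-(2 * lorentzian z₀ w)
        + 8 * (w ^ 2 / z₀ ^ 2 * lorentzian z₀ w) * lorentzian z₀ w) := by
    rw [deriv_lorentzian hz₀]
    field_simp
    ring
  have hn : 0 ≤ w ^ 2 / z₀ ^ 2 * lorentzian z₀ w := by positivity
  have hx : |-(2 * lorentzian z₀ w)
      + 8 * (w ^ 2 / z₀ ^ 2 * lorentzian z₀ w) * lorentzian z₀ w| ≤ 10 := by
    rw [abs_le]; constructor <;> nlinarith
  rw [e, abs_mul, abs_of_pos (by positivity : 0 < lorentzian z₀ w / z₀ ^ 2)]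
  calc _ ≤ lorentzian z₀ w / z₀ ^ 2 * 10 := by gcongr
    _ = _ := by ring

variable {F₀ k b : ℝ}

theorem abs_Fz_lorentzian_le (hF₀ : 0 < F₀) (hk : 0 < k) (hz₀ : 0 < z₀) (t z : ℝ) :
    |Fz F₀ k b (lorentzian z₀) t z| ≤ F₀ * (k + 1 / z₀) * lorentzian z₀ z := by
  have hp := lorentzian_pos hz₀ z
  have hd := abs_deriv_lorentzian_le hz₀ z
  have hc : Real.cos (k * z - b * t / 2) ^ 2 ≤ 1 := Real.cos_sq_le_one _
  have hs := Real.abs_sin_le_one (2 * k * z - b * t)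
  unfold Fz
  refine (abs_add_le _ _).trans ?_
  simp only [abs_mul, abs_neg, abs_of_pos hF₀, abs_of_pos hk, abs_of_pos hp, abs_pow, sq_abs]
  calc _ ≤ k * F₀ * lorentzian z₀ z * 1 + F₀ * 1 * (lorentzian z₀ z / z₀) := by gcongr
    _ = _ := by ring

theorem hasDerivAt_Fz_lorentzian (hz₀ : 0 < z₀) (t z : ℝ) :
    HasDerivAt (Fz F₀ k b (lorentzian z₀) t)
      (-(2 * k * F₀) * deriv (lorentzian z₀) z * Real.sin (2 * k * z - b * t)
        - 2 * k ^ 2 * F₀ * lorentzian z₀ z * Real.cos (2 * k * z - b * t)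
        + F₀ * Real.cos (k * z - b * t / 2) ^ 2 * (-(2 / z₀ ^ 2) * lorentzian z₀ z ^ 2
          - 4 * z / z₀ ^ 2 * lorentzian z₀ z * deriv (lorentzian z₀) z)) z := by
  have hf : HasDerivAt (lorentzian z₀) (deriv (lorentzian z₀) z) z :=
    (hasDerivAt_lorentzian hz₀ z).differentiableAt.hasDerivAt
  have hφ : HasDerivAt (fun z => 2 * k * z - b * t) (2 * k) z := by
    simpa using ((hasDerivAt_id z).const_mul (2 * k)).sub_const (b * t)
  have hψ : HasDerivAt (fun z => k * z - b * t / 2) k z := by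
    simpa using ((hasDerivAt_id z).const_mul k).sub_const (b * t / 2)
  have h := ((hf.const_mul (-k * F₀)).mul hφ.sin).add
    (((hψ.cos.pow 2).const_mul F₀).mul (hasDerivAt_deriv_lorentzian hz₀ z))
  have e : Real.sin (2 * k * z - b * t)
      = 2 * Real.sin (k * z - b * t / 2) * Real.cos (k * z - b * t / 2) := by
    rw [← Real.sin_two_mul]; ring_nf
  refine h.congr_deriv ?_
  rw [e, Pi.pow_apply]
  push_cast
  ring

theorem abs_Fz_lorentzian_sub_le (hF₀ : 0 < F₀) (hk : 0 < k) (hz₀ : 0 < z₀) (t : ℝ)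
    {s : Set ℝ} (hs : Convex ℝ s) {c : ℝ} (hc : ∀ y ∈ s, lorentzian z₀ y ≤ c) {x y : ℝ}
    (hx : x ∈ s) (hy : y ∈ s) :
    |Fz F₀ k b (lorentzian z₀) t y - Fz F₀ k b (lorentzian z₀) t x|
      ≤ F₀ * (2 * k / z₀ + 2 * k ^ 2 + 10 / z₀ ^ 2) * c * |y - x| := by
  refine hs.norm_image_sub_le_of_norm_hasDerivWithin_le
    (fun z _ => (hasDerivAt_Fz_lorentzian hz₀ t z).hasDerivWithinAt) (fun z hz => ?_) hx hy
  have hp := lorentzian_pos hz₀ z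
  have hd := abs_deriv_lorentzian_le hz₀ z
  have hdd := abs_second_deriv_lorentzian_le hz₀ z
  have hcos : Real.cos (k * z - b * t / 2) ^ 2 ≤ 1 := Real.cos_sq_le_one _
  have hs' := Real.abs_sin_le_one (2 * k * z - b * t)
  have hc' := Real.abs_cos_le_one (2 * k * z - b * t)
  have h1 : |-(2 * k * F₀) * deriv (lorentzian z₀) z * Real.sin (2 * k * z - b * t)|
      ≤ 2 * k * F₀ * (lorentzian z₀ z / z₀) * 1 := by
    rw [abs_mul, abs_mul, abs_neg, abs_of_pos (by positivity : 0 < 2 * k * F₀)]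
    gcongr
  have h2 : |2 * k ^ 2 * F₀ * lorentzian z₀ z * Real.cos (2 * k * z - b * t)|
      ≤ 2 * k ^ 2 * F₀ * lorentzian z₀ z * 1 := by
    rw [abs_mul, abs_of_pos (by positivity : 0 < 2 * k ^ 2 * F₀ * lorentzian z₀ z)]
    gcongr
  have h3 : |F₀ * Real.cos (k * z - b * t / 2) ^ 2 * (-(2 / z₀ ^ 2) * lorentzian z₀ z ^ 2
      - 4 * z / z₀ ^ 2 * lorentzian z₀ z * deriv (lorentzian z₀) z)|
      ≤ F₀ * 1 * (10 * lorentzian z₀ z / z₀ ^ 2) := by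
    rw [abs_mul, abs_of_nonneg (by positivity : 0 ≤ F₀ * Real.cos (k * z - b * t / 2) ^ 2)]
    gcongr
  rw [Real.norm_eq_abs]
  calc _ ≤ _ := (abs_add_le _ _).trans (add_le_add (abs_sub _ _) le_rfl)
    _ ≤ _ := add_le_add (add_le_add h1 h2) h3
    _ = F₀ * (2 * k / z₀ + 2 * k ^ 2 + 10 / z₀ ^ 2) * lorentzian z₀ z := by ring
    _ ≤ _ := by gcongr; exact hc z hz

theorem Fz_add_period (hb : b ≠ 0) (f : ℝ → ℝ) (t z : ℝ) :
    Fz F₀ k b f (t + 4 * Real.pi / b) z = Fz F₀ k b f t z := by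
  have h1 : 2 * k * z - b * (t + 4 * Real.pi / b)
      = 2 * k * z - b * t - (2 : ℕ) * (2 * Real.pi) := by
    field_simp
    push_cast
    ring
  have h2 : k * z - b * (t + 4 * Real.pi / b) / 2 = k * z - b * t / 2 - 2 * Real.pi := by
    field_simp
    ring
  rw [Fz, Fz, h1, h2, Real.sin_sub_nat_mul_two_pi, Real.cos_sub_two_pi]

/-- An antiderivative in time of the force at a fixed position. -/
theorem hasDerivAt_antideriv_Fz (hb : b ≠ 0) (f : ℝ → ℝ) (z t : ℝ) :
    HasDerivAt (fun t => -(k * F₀ * f z / b) * Real.cos (2 * k * z - b * t)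
      + F₀ * deriv f z * (t / 2 - Real.sin (2 * k * z - b * t) / (2 * b)))
      (Fz F₀ k b f t z) t := by
  have hφ : HasDerivAt (fun t => 2 * k * z - b * t) (-b) t := by
    simpa using ((hasDerivAt_id t).const_mul b).const_sub (2 * k * z)
  have h := (hφ.cos.const_mul (-(k * F₀ * f z / b))).add
    ((((hasDerivAt_id t).div_const 2).sub (hφ.sin.div_const (2 * b))).const_mul (F₀ * deriv f z))
  refine h.congr_deriv ?_
  rw [Fz, Real.cos_sq, show 2 * (k * z - b * t / 2) = 2 * k * z - b * t by ring]
  field_simp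
  ring

/-- Far from the origin, one period displaces a solution by the averaged force
`F₀ f' / 2` times the period, up to an error quadratic in the profile. -/
theorem abs_displacement_sub_le (hF₀ : 0 < F₀) (hk : 0 < k) (hb : 0 < b) (hz₀ : 0 < z₀)
    {T : ℝ} (hT : T = 4 * Real.pi / b) {z : ℝ → ℝ}
    (hz : ∀ t ∈ Icc 0 T, HasDerivWithinAt z (Fz F₀ k b (lorentzian z₀) t (z t)) (Icc 0 T) t)
    (hfar : 2 * (F₀ * (k + 1 / z₀)) * T ≤ |z 0|) :
    |z T - z 0 + F₀ * T * z 0 / z₀ ^ 2 * lorentzian z₀ (z 0) ^ 2|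
      ≤ 16 * (F₀ * (2 * k / z₀ + 2 * k ^ 2 + 10 / z₀ ^ 2)) * (F₀ * (k + 1 / z₀)) * T ^ 2
        * lorentzian z₀ (z 0) ^ 2 := by
  have hT0 : 0 < T := by rw [hT]; positivity
  set M := F₀ * (k + 1 / z₀) with hM
  set K := F₀ * (2 * k / z₀ + 2 * k ^ 2 + 10 / z₀ ^ 2) with hK
  set Z := z 0 with hZ
  set p := lorentzian z₀ Z with hp
  have hM0 : 0 < M := by positivity
  have hK0 : 0 < K := by positivity
  have hp0 : 0 < p := lorentzian_pos hz₀ Z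
  have hclose : ∀ t ∈ Icc 0 T, |z t - Z| ≤ |Z| / 2 := by
    intro t ht
    have h := norm_image_sub_le_of_norm_deriv_le_segment' hz (C := M) (fun s _ =>
      (abs_Fz_lorentzian_le hF₀ hk hz₀ s (z s)).trans
        (mul_le_of_le_one_right hM0.le (lorentzian_le_one hz₀ _))) t ht
    rw [Real.norm_eq_abs, sub_zero] at h
    nlinarith [mul_le_mul_of_nonneg_left ht.2 hM0.le]
  have hclose' : ∀ t ∈ Icc 0 T, |z t - Z| ≤ 4 * M * p * T := by
    intro t ht
    have h := norm_image_sub_le_of_norm_deriv_le_segment' hz (C := M * (4 * p)) (fun s hs =>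
      (abs_Fz_lorentzian_le hF₀ hk hz₀ s (z s)).trans
        (mul_le_mul_of_nonneg_left
          (lorentzian_le_four_mul hz₀ (hclose s (Ico_subset_Icc_self hs))) hM0.le)) t ht
    rw [Real.norm_eq_abs, sub_zero] at h
    calc _ ≤ M * (4 * p) * t := h
      _ ≤ M * (4 * p) * T := by gcongr; exact ht.2
      _ = _ := by ring
  have hg : ∀ t ∈ Icc 0 T, HasDerivWithinAt _ _ (Icc 0 T) t := fun t ht =>
    (hz t ht).sub (hasDerivAt_antideriv_Fz (F₀ := F₀) (k := k) hb.ne'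
      (lorentzian z₀) Z t).hasDerivWithinAt
  have h := norm_image_sub_le_of_norm_deriv_le_segment' hg (C := K * (4 * p) * (4 * M * p * T))
    (fun s hs => by
      have hs' := Ico_subset_Icc_self hs
      refine (abs_Fz_lorentzian_sub_le (s := Metric.closedBall Z (|Z| / 2)) hF₀ hk hz₀ s
        (convex_closedBall _ _) (fun y hy => lorentzian_le_four_mul hz₀ hy)
        (Metric.mem_closedBall_self (by positivity)) (hclose s hs')).trans ?_
      gcongr
      exact hclose' s hs') T ⟨hT0.le, le_rfl⟩
  have hbT : 2 * k * Z - b * T = 2 * k * Z - (2 : ℕ) * (2 * Real.pi) := by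
    rw [hT]
    field_simp
    push_cast
    ring
  rw [Real.norm_eq_abs] at h
  simp only [Pi.sub_apply, hbT, Real.sin_sub_nat_mul_two_pi, Real.cos_sub_nat_mul_two_pi,
    deriv_lorentzian hz₀, mul_zero, sub_zero] at h
  calc _ = _ := by
        congr 1
        ring
    _ ≤ _ := h
    _ = _ := by ring

end Lorentzian

/-- Existence of a solution of the periodic boundary-value problem for
`z' = F_z(t,z)` in the Lorentzian case `f(z) = z₀²/(z₀² + z²)`, and consequently
of a `T`-periodic solution defined on all of `ℝ`. -/
theorem exists_periodic_solution_lorentzian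
    (F₀ k b z₀ : ℝ) (hF₀ : 0 < F₀) (hk : 0 < k) (hb : 0 < b) (hz₀ : 0 < z₀)
    (T : ℝ) (hT : T = 4 * Real.pi / b)
    (f : ℝ → ℝ) (hf : f = fun w => z₀ ^ 2 / (z₀ ^ 2 + w ^ 2)) :
    (∃ z : ℝ → ℝ,
      (∀ t ∈ Set.Icc 0 T, HasDerivWithinAt z (Fz F₀ k b f t (z t)) (Set.Icc 0 T) t) ∧
      z 0 = z T) ∧
    (∃ w : ℝ → ℝ, (∀ t : ℝ, w (t + T) = w t) ∧
      ∀ t : ℝ, HasDerivAt w (Fz F₀ k b f t (w t)) t) := by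
  have hT0 : 0 < T := by rw [hT]; positivity
  obtain rfl : f = lorentzian z₀ := hf
  set M := F₀ * (k + 1 / z₀) with hM
  set K := F₀ * (2 * k / z₀ + 2 * k ^ 2 + 10 / z₀ ^ 2) with hK
  have hM0 : 0 < M := by positivity
  have hK0 : 0 < K := by positivity
  set R := 2 * M * T + 16 * K * M * T * z₀ ^ 2 / F₀ with hR
  have hR0 : 0 < R := by positivity
  have hRM : 2 * M * T ≤ R := le_add_of_nonneg_right (by positivity)
  have hRK : 16 * K * M * T ^ 2 ≤ F₀ * T * R / z₀ ^ 2 := by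
    have : F₀ * T * R / z₀ ^ 2 = 16 * K * M * T ^ 2 + F₀ * T * (2 * M * T) / z₀ ^ 2 := by
      rw [hR]
      field_simp
      ring
    rw [this]
    exact le_add_of_nonneg_right (by positivity)
  have hper : ∀ t x, Fz F₀ k b (lorentzian z₀) (t + T) x = Fz F₀ k b (lorentzian z₀) t x := by
    rw [hT]
    exact Fz_add_period hb.ne' _
  obtain ⟨z, hz, hzT⟩ := exists_eq_endpoints_of_lipschitz (v := Fz F₀ k b (lorentzian z₀))
    (K := ⟨K, hK0.le⟩) (M := ⟨M, hM0.le⟩) (a := -R) (b := R) hT0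
    (fun x => by unfold Fz; fun_prop)
    (fun t => LipschitzWith.of_dist_le_mul fun x y => by
      simpa only [mul_one] using! abs_Fz_lorentzian_sub_le (b := b) hF₀ hk hz₀ t convex_univ
        (fun y _ => lorentzian_le_one hz₀ y) (mem_univ y) (mem_univ x))
    (fun t x => (abs_Fz_lorentzian_le hF₀ hk hz₀ t x).trans
      (mul_le_of_le_one_right hM0.le (lorentzian_le_one hz₀ _)))
    (by linarith)
    (fun z hz h0 => by
      have h := abs_displacement_sub_le hF₀ hk hb hz₀ hT hz (by rwa [h0, abs_of_pos hR0])
      rw [h0] at h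
      have h' := mul_le_mul_of_nonneg_right hRK (sq_nonneg (lorentzian z₀ R))
      linarith [(abs_le.1 h).2])
    (fun z hz h0 => by
      have h := abs_displacement_sub_le hF₀ hk hb hz₀ hT hz
        (by rwa [h0, abs_neg, abs_of_pos hR0])
      rw [h0, mul_neg, neg_div, neg_mul] at h
      have h' := mul_le_mul_of_nonneg_right hRK (sq_nonneg (lorentzian z₀ (-R)))
      linarith [(abs_le.1 h).1])
  exact ⟨⟨z, hz, hzT⟩, exists_periodic_hasDerivAt_of_Icc hT0 hper hz hzT⟩
end

section
/- Let f(z) = exp(−2z²/z₀²) with z₀ > 0. There exists a C¹ function z : [0,T] → ℝ satisfying z'(t) = F_z(t, z(t)) for all t ∈ [0,T] and z(0) = z(T); consequently, by T-periodic extension, the equation z' = F_z(t,z) has a T-periodic solution defined on all of ℝ. -/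
open Filter Set

/-- A solution of a `T`-periodic equation on `[0, T]` with equal boundary values extends
to a `T`-periodic solution on the whole line. -/
theorem exists_periodic_extension_of_solution {v : ℝ → ℝ → ℝ} {T : ℝ} (hT : 0 < T)
    (hv : ∀ x, Function.Periodic (fun t => v t x) T) {z : ℝ → ℝ}
    (hz : ∀ t ∈ Icc 0 T, HasDerivWithinAt z (v t (z t)) (Icc 0 T) t) (hzT : z 0 = z T) :
    ∃ w : ℝ → ℝ, (∀ t, w (t + T) = w t) ∧ ∀ t, HasDerivAt w (v t (w t)) t := by
  set w : ℝ → ℝ := fun t => z (toIcoMod hT 0 t) with hw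
  have hper : Function.Periodic w T := fun t => by simp [hw]
  have heq : EqOn w z (Icc 0 T) := by
    intro t ht
    rcases ht.2.lt_or_eq with h | rfl
    · simp only [hw]
      rw [(toIcoMod_eq_self hT).2 ⟨ht.1, by simpa using h⟩]
    · have : w (0 + t) = w 0 := hper 0
      rw [zero_add] at this
      rw [this, ← hzT, hw]
      simp
  have hwI : ∀ t ∈ Icc 0 T, HasDerivWithinAt w (v t (w t)) (Icc 0 T) t := by
    intro t ht
    rw [heq ht]
    exact (hz t ht).congr heq (heq ht)
  have hIco : ∀ t ∈ Ico 0 T, HasDerivAt w (v t (w t)) t := by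
    intro t ht
    rcases ht.1.eq_or_lt with rfl | h0
    · have hr : HasDerivWithinAt w (v 0 (w 0)) (Ici 0) 0 :=
        (hwI 0 ⟨le_rfl, hT.le⟩).mono_of_mem_nhdsWithin (Icc_mem_nhdsGE hT)
      have hl : HasDerivWithinAt w (v T (w T)) (Iic T) T :=
        (hwI T ⟨hT.le, le_rfl⟩).mono_of_mem_nhdsWithin (Icc_mem_nhdsLE hT)
      have hvT : v T (w T) = v 0 (w 0) := by
        have h1 := hv (w 0) 0
        have h2 := hper 0
        simp only [zero_add] at h1 h2
        rw [h2, h1]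
      have hl' : HasDerivWithinAt w (v 0 (w 0)) (Iic 0) 0 := by
        have hs : HasDerivWithinAt (fun x : ℝ => x + T) 1 (Iic 0) 0 :=
          (hasDerivWithinAt_id 0 _).add_const T
        have hl0 : HasDerivWithinAt w (v T (w T)) (Iic T) ((fun x : ℝ => x + T) 0) := by
          simpa using hl
        have := hl0.comp (0 : ℝ) hs (fun x hx => by simpa using hx)
        rw [hvT, mul_one] at this
        exact this.congr (fun x _ => (hper x).symm) (hper 0).symm
      have := hl'.union hr
      rwa [Iic_union_Ici, hasDerivWithinAt_univ] at this
    · exact (hwI t ⟨h0.le, ht.2.le⟩).hasDerivAt (Icc_mem_nhds h0 ht.2)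
  refine ⟨w, hper, fun t => ?_⟩
  have hs := hIco _ (toIcoMod_mem_Ico' hT t)
  have hsub : toIcoMod hT 0 t = t - toIcoDiv hT 0 t * T := by
    rw [eq_sub_iff_add_eq]
    simp
  rw [hsub] at hs
  have hw' : w (t - toIcoDiv hT 0 t * T) = w t := hper.sub_int_mul_eq _
  rw [hw', (hv (w t)).sub_int_mul_eq] at hs
  refine (hs.comp_sub_const t _).congr_of_eventuallyEq (Eventually.of_forall fun x => ?_)
  exact (hper.sub_int_mul_eq _).symm

/-- If the flow of a bounded `C¹` vector field maps the endpoints of `[-M, M]` inwards after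
time `T`, then some solution takes equal values at times `0` and `T`. -/
theorem exists_solution_eq_boundary {v : ℝ → ℝ → ℝ} {T B M : ℝ} (hT : 0 < T) (hM : 0 ≤ M)
    (hv : ContDiff ℝ 1 (Function.uncurry v)) (hB : ∀ t x, |v t x| ≤ B)
    (hup : ∀ z : ℝ → ℝ, (∀ t ∈ Icc 0 T, HasDerivWithinAt z (v t (z t)) (Icc 0 T) t) →
      z 0 = M → z T ≤ M)
    (hlow : ∀ z : ℝ → ℝ, (∀ t ∈ Icc 0 T, HasDerivWithinAt z (v t (z t)) (Icc 0 T) t) →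
      z 0 = -M → -M ≤ z T) :
    ∃ z : ℝ → ℝ, (∀ t ∈ Icc 0 T, HasDerivWithinAt z (v t (z t)) (Icc 0 T) t) ∧ z 0 = z T := by
  have hB0 : 0 ≤ B := (abs_nonneg _).trans (hB 0 0)
  lift B to NNReal using hB0
  lift M to NNReal using hM
  lift T to NNReal using hT.le
  obtain ⟨K, hK⟩ := (hv.contDiffOn (s := Icc (0 : ℝ) T ×ˢ Metric.closedBall (0 : ℝ) (M + B * T))
    ).exists_lipschitzOnWith one_ne_zero ((convex_Icc _ _).prod (convex_closedBall _ _))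
      (isCompact_Icc.prod (isCompact_closedBall _ _))
  have hPL : IsPicardLindelof v (tmin := 0) (tmax := T) ⟨0, le_rfl, hT.le⟩ 0 (M + B * T) M B K :=
    { lipschitzOnWith := by
        intro t ht x hx y hy
        have := hK (x := (t, x)) ⟨ht, by simpa using hx⟩ (y := (t, y)) ⟨ht, by simpa using hy⟩
        simpa [Prod.edist_eq] using this
      continuousOn := by
        intro x _
        exact (hv.continuous.comp (by fun_prop : Continuous fun t : ℝ => (t, x))).continuousOn
      norm_le := fun t _ x _ => hB t x
      mul_max_le := by simp }
  obtain ⟨α, hα, L, hL⟩ :=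
    hPL.exists_forall_mem_closedBall_eq_hasDerivWithinAt_lipschitzOnWith
  have hball : Metric.closedBall (0 : ℝ) M = Icc (-(M : ℝ)) M := by
    simp [Real.closedBall_eq_Icc]
  rw [hball] at hα hL
  have hcont : ContinuousOn (fun x => α x T - x) (Icc (-(M : ℝ)) M) :=
    (hL T ⟨hT.le, le_rfl⟩).continuousOn.sub continuousOn_id
  have hle : -(M : ℝ) ≤ M := by linarith [M.coe_nonneg]
  have hmemM : (M : ℝ) ∈ Icc (-(M : ℝ)) M := ⟨hle, le_rfl⟩
  have hmemN : -(M : ℝ) ∈ Icc (-(M : ℝ)) M := ⟨le_rfl, hle⟩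
  have h1 := hup _ (hα _ hmemM).2 (hα _ hmemM).1
  have h2 := hlow _ (hα _ hmemN).2 (hα _ hmemN).1
  obtain ⟨x, hx, hx0⟩ := intermediate_value_Icc' hle hcont
    (show (0 : ℝ) ∈ Icc _ _ from ⟨by linarith, by linarith⟩)
  exact ⟨α x, (hα x hx).2, by rw [(hα x hx).1]; simp only at hx0; linarith⟩

theorem hasDerivAt_gaussian (a z : ℝ) :
    HasDerivAt (fun w : ℝ => Real.exp (-2 * w ^ 2 / a ^ 2))
      (-(4 * z / a ^ 2) * Real.exp (-2 * z ^ 2 / a ^ 2)) z := by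
  have h := ((((hasDerivAt_id' z).fun_pow 2).const_mul (-2)).div_const (a ^ 2)).exp
  convert h using 1
  simp
  ring

theorem Fz_gaussian (F₀ k b a t z : ℝ) :
    Fz F₀ k b (fun w => Real.exp (-2 * w ^ 2 / a ^ 2)) t z =
      -F₀ * Real.exp (-2 * z ^ 2 / a ^ 2) * Real.cos (k * z - b * t / 2) *
        (2 * k * Real.sin (k * z - b * t / 2) +
          4 * z / a ^ 2 * Real.cos (k * z - b * t / 2)) := by
  have h : 2 * k * z - b * t = 2 * (k * z - b * t / 2) := by ring
  rw [Fz, (hasDerivAt_gaussian a z).deriv, h, Real.sin_two_mul]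
  ring

theorem abs_Fz_gaussian_le {F₀ k a : ℝ} (b : ℝ) (hF₀ : 0 < F₀) (hk : 0 < k) (t z : ℝ) :
    |Fz F₀ k b (fun w => Real.exp (-2 * w ^ 2 / a ^ 2)) t z| ≤
      F₀ * Real.exp (-2 * z ^ 2 / a ^ 2) * (2 * k + 4 * |z| / a ^ 2) := by
  rw [Fz_gaussian]
  generalize k * z - b * t / 2 = θ
  have hs := Real.abs_sin_le_one θ
  have hc := Real.abs_cos_le_one θ
  have h1 : |2 * k * Real.sin θ + 4 * z / a ^ 2 * Real.cos θ| ≤ 2 * k + 4 * |z| / a ^ 2 := by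
    refine (abs_add_le _ _).trans (add_le_add ?_ ?_)
    · rw [abs_mul, abs_of_pos (by positivity : 0 < 2 * k)]
      exact mul_le_of_le_one_right (by positivity) hs
    · rw [abs_mul, abs_div, abs_mul, abs_of_nonneg (sq_nonneg a), abs_of_pos (four_pos : (0:ℝ) < 4)]
      exact mul_le_of_le_one_right (by positivity) hc
  rw [abs_mul, abs_mul, abs_mul, abs_neg, abs_of_pos hF₀, Real.abs_exp]
  exact mul_le_mul (mul_le_of_le_one_right (by positivity) hc) h1 (abs_nonneg _) (by positivity)

theorem exp_mul_abs_le {a : ℝ} (ha : 0 < a) (z : ℝ) :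
    Real.exp (-2 * z ^ 2 / a ^ 2) * |z| ≤ a := by
  have h1 := Real.add_one_le_exp (2 * z ^ 2 / a ^ 2)
  have h2 : |z| ≤ a * Real.exp (2 * z ^ 2 / a ^ 2) := by
    have h3 : |z| / a ≤ 2 * z ^ 2 / a ^ 2 + 1 := by
      have : 2 * z ^ 2 / a ^ 2 = 2 * (|z| / a) ^ 2 := by rw [div_pow, sq_abs]; ring
      rw [this]
      nlinarith [sq_nonneg (|z| / a - 1 / 2)]
    rw [div_le_iff₀ ha] at h3
    nlinarith
  have h4 : -2 * z ^ 2 / a ^ 2 = -(2 * z ^ 2 / a ^ 2) := by ring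
  rw [h4, Real.exp_neg, inv_mul_le_iff₀ (Real.exp_pos _), mul_comm]
  exact h2

theorem Fz_gaussian_bounded {F₀ k a : ℝ} (b : ℝ) (hF₀ : 0 < F₀) (hk : 0 < k) (ha : 0 < a)
    (t z : ℝ) :
    |Fz F₀ k b (fun w => Real.exp (-2 * w ^ 2 / a ^ 2)) t z| ≤ F₀ * (2 * k + 4 / a) := by
  refine (abs_Fz_gaussian_le b hF₀ hk t z).trans ?_
  rw [mul_assoc]
  refine mul_le_mul_of_nonneg_left ?_ hF₀.le
  have h1 : Real.exp (-2 * z ^ 2 / a ^ 2) ≤ 1 :=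
    Real.exp_le_one_iff.2 (div_nonpos_of_nonpos_of_nonneg (by nlinarith [sq_nonneg z]) (sq_nonneg a))
  have h2 := mul_le_mul_of_nonneg_left (exp_mul_abs_le ha z) (by positivity : 0 ≤ 4 / a ^ 2)
  have h3 : 4 / a ^ 2 * a = 4 / a := by field_simp
  calc Real.exp (-2 * z ^ 2 / a ^ 2) * (2 * k + 4 * |z| / a ^ 2)
      = Real.exp (-2 * z ^ 2 / a ^ 2) * (2 * k) +
        4 / a ^ 2 * (Real.exp (-2 * z ^ 2 / a ^ 2) * |z|) := by ring
    _ ≤ 1 * (2 * k) + 4 / a := add_le_add (by gcongr) (h2.trans h3.le)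
    _ = 2 * k + 4 / a := by ring

theorem tendsto_pow_mul_gaussian {a : ℝ} (ha : 0 < a) (n : ℕ) :
    Tendsto (fun z : ℝ => z ^ n * Real.exp (-2 * z ^ 2 / a ^ 2)) atTop (nhds 0) := by
  refine squeeze_zero' ?_ ?_ (Real.tendsto_pow_mul_exp_neg_atTop_nhds_zero n)
  · filter_upwards [eventually_ge_atTop 0] with z hz
    positivity
  · filter_upwards [eventually_ge_atTop (a ^ 2), eventually_ge_atTop 0] with z hz hz0
    gcongr
    rw [div_le_iff₀ (by positivity)]
    nlinarith

/-- Far from the origin the Gaussian force is small, and the confining term of the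
averaged force dominates. -/
theorem exists_gaussian_threshold (F₀ k b : ℝ) {a : ℝ} (ha : 0 < a) :
    ∃ M, 0 < M ∧ ∀ z, M ≤ z →
      2 * k / b * (F₀ * Real.exp (-2 * z ^ 2 / a ^ 2) * (2 * k + 4 * z / a ^ 2)) < 1 ∧
      2 * k / b * F₀ * Real.exp (-2 * z ^ 2 / a ^ 2) * (2 * k + 4 * z / a ^ 2) ^ 2 ≤
        4 * z / a ^ 2 := by
  have h0 := tendsto_pow_mul_gaussian ha 0
  have h1 := tendsto_pow_mul_gaussian ha 1
  have h2 := tendsto_pow_mul_gaussian ha 2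
  have hA : Tendsto (fun z : ℝ =>
      2 * k / b * (F₀ * Real.exp (-2 * z ^ 2 / a ^ 2) * (2 * k + 4 * z / a ^ 2))) atTop (nhds 0) := by
    have := (h0.const_mul (2 * k / b * F₀ * (2 * k))).add
      (h1.const_mul (2 * k / b * F₀ * (4 / a ^ 2)))
    simp only [mul_zero, add_zero] at this
    exact this.congr fun z => by ring
  have hB : Tendsto (fun z : ℝ =>
      2 * k / b * F₀ * Real.exp (-2 * z ^ 2 / a ^ 2) * (2 * k + 4 * z / a ^ 2) ^ 2)
      atTop (nhds 0) := by
    have := ((h0.const_mul (2 * k / b * F₀ * (2 * k) ^ 2)).add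
      (h1.const_mul (2 * k / b * F₀ * (2 * (2 * k) * (4 / a ^ 2))))).add
      (h2.const_mul (2 * k / b * F₀ * (4 / a ^ 2) ^ 2))
    simp only [mul_zero, add_zero] at this
    exact this.congr fun z => by ring
  obtain ⟨M, hM⟩ := eventually_atTop.1 ((hA.eventually_lt_const one_pos).and
    (hB.eventually_lt_const (by positivity : 0 < 4 / a ^ 2)))
  refine ⟨max M 1, by positivity, fun z hz => ⟨(hM z (le_of_max_le_left hz)).1, ?_⟩⟩
  refine (hM z (le_of_max_le_left hz)).2.le.trans ?_
  have hz1 : 1 ≤ z := le_of_max_le_right hz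
  gcongr
  linarith

/-- The force is the `z`-derivative of the potential `F₀ f(z) cos²(kz − bt/2)`. -/
theorem hasDerivAt_potential (F₀ k b a t z : ℝ) :
    HasDerivAt (fun w => F₀ * Real.exp (-2 * w ^ 2 / a ^ 2) * Real.cos (k * w - b * t / 2) ^ 2)
      (Fz F₀ k b (fun w => Real.exp (-2 * w ^ 2 / a ^ 2)) t z) z := by
  have hc := ((((hasDerivAt_id' z).const_mul k).sub_const (b * t / 2)).cos).fun_pow 2
  refine (((hasDerivAt_gaussian a z).const_mul F₀).fun_mul hc).congr_deriv ?_
  rw [Fz_gaussian]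
  simp
  ring

/-- The derivative along solutions of `z + (2k/b) F₀ f(z) cos²(kz − bt/2)`. -/
theorem hasDerivWithinAt_corrected {F₀ k b a t : ℝ} (hb : b ≠ 0) {z : ℝ → ℝ} {s : Set ℝ}
    (hz : HasDerivWithinAt z (Fz F₀ k b (fun w => Real.exp (-2 * w ^ 2 / a ^ 2)) t (z t)) s t) :
    HasDerivWithinAt
      (fun t => z t + 2 * k / b *
        (F₀ * Real.exp (-2 * z t ^ 2 / a ^ 2) * Real.cos (k * z t - b * t / 2) ^ 2))
      (F₀ * Real.exp (-2 * z t ^ 2 / a ^ 2) * Real.cos (k * z t - b * t / 2) ^ 2 *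
        (2 * k / b * F₀ * Real.exp (-2 * z t ^ 2 / a ^ 2) *
          (2 * k * Real.sin (k * z t - b * t / 2) +
            4 * z t / a ^ 2 * Real.cos (k * z t - b * t / 2)) ^ 2 - 4 * z t / a ^ 2)) s t := by
  have hlin : HasDerivWithinAt (fun t => b * t / 2) (b / 2) s t := by
    simpa using ((hasDerivWithinAt_id t s).const_mul b).div_const 2
  have hc := (((hz.const_mul k).fun_sub hlin).cos).fun_pow 2
  have hg := (hasDerivAt_gaussian a (z t)).comp_hasDerivWithinAt t hz
  refine (hz.fun_add (((hg.const_mul F₀).fun_mul hc).const_mul (2 * k / b))).congr_deriv ?_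
  rw [Fz_gaussian]
  simp
  field_simp
  ring

theorem strictMonoOn_corrected {F₀ k b a : ℝ} (hF₀ : 0 < F₀) (hk : 0 < k) (hb : 0 < b)
    {s : Set ℝ} (hs : Convex ℝ s)
    (h : ∀ z ∈ s, 2 * k / b * (F₀ * Real.exp (-2 * z ^ 2 / a ^ 2) * (2 * k + 4 * |z| / a ^ 2)) < 1)
    (t : ℝ) :
    StrictMonoOn (fun z => z + 2 * k / b *
      (F₀ * Real.exp (-2 * z ^ 2 / a ^ 2) * Real.cos (k * z - b * t / 2) ^ 2)) s := by
  have hd := fun z => (hasDerivAt_id' z).fun_add ((hasDerivAt_potential F₀ k b a t z).const_mul (2 * k / b))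
  refine strictMonoOn_of_hasDerivWithinAt_pos hs
    (fun z _ => (hd z).continuousAt.continuousWithinAt)
    (fun z _ => (hd z).hasDerivWithinAt) fun z hz => ?_
  have h1 := neg_le_of_abs_le (abs_Fz_gaussian_le (a := a) b hF₀ hk t z)
  have h2 := mul_le_mul_of_nonneg_left h1 (by positivity : 0 ≤ 2 * k / b)
  have h3 := h z (interior_subset hz)
  linarith

theorem solution_displacement_le {v : ℝ → ℝ → ℝ} {T B : ℝ} (hB : ∀ t x, |v t x| ≤ B)
    {z : ℝ → ℝ} (hz : ∀ t ∈ Icc 0 T, HasDerivWithinAt z (v t (z t)) (Icc 0 T) t)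
    {t : ℝ} (ht : t ∈ Icc 0 T) : |z t - z 0| ≤ B * T := by
  have hB0 : 0 ≤ B := (abs_nonneg _).trans (hB 0 0)
  have h := (convex_Icc 0 T).norm_image_sub_le_of_norm_hasDerivWithin_le hz
    (fun s _ => hB s (z s)) ⟨le_rfl, ht.1.trans ht.2⟩ ht
  rw [Real.norm_eq_abs, Real.norm_eq_abs, sub_zero, abs_of_nonneg ht.1] at h
  exact h.trans (mul_le_mul_of_nonneg_left ht.2 hB0)

theorem cos_phase_sub_period {b : ℝ} (hb : b ≠ 0) (x t : ℝ) :
    Real.cos (x - b * (t + 4 * Real.pi / b) / 2) = Real.cos (x - b * t / 2) := by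
  have : x - b * (t + 4 * Real.pi / b) / 2 = x - b * t / 2 - 2 * Real.pi := by
    field_simp
    ring
  rw [this, Real.cos_sub_two_pi]

theorem sin_phase_sub_period {b : ℝ} (hb : b ≠ 0) (x t : ℝ) :
    Real.sin (x - b * (t + 4 * Real.pi / b) / 2) = Real.sin (x - b * t / 2) := by
  have : x - b * (t + 4 * Real.pi / b) / 2 = x - b * t / 2 - 2 * Real.pi := by
    field_simp
    ring
  rw [this, Real.sin_sub_two_pi]

theorem contDiff_Fz_gaussian (F₀ k b a : ℝ) :
    ContDiff ℝ 1 (Function.uncurry (Fz F₀ k b (fun w => Real.exp (-2 * w ^ 2 / a ^ 2)))) := by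
  have : Function.uncurry (Fz F₀ k b (fun w => Real.exp (-2 * w ^ 2 / a ^ 2))) = fun p : ℝ × ℝ =>
      -F₀ * Real.exp (-2 * p.2 ^ 2 / a ^ 2) * Real.cos (k * p.2 - b * p.1 / 2) *
        (2 * k * Real.sin (k * p.2 - b * p.1 / 2) +
          4 * p.2 / a ^ 2 * Real.cos (k * p.2 - b * p.1 / 2)) := by
    funext p
    exact Fz_gaussian F₀ k b a p.1 p.2
  rw [this]
  fun_prop

/-- Existence of a solution of the periodic boundary-value problem for
`z' = F_z(t,z)` in the Gaussian case `f(z) = exp(−2z²/z₀²)`, and consequently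
of a `T`-periodic solution defined on all of `ℝ`. -/
theorem exists_periodic_solution_gaussian
    (F₀ k b z₀ : ℝ) (hF₀ : 0 < F₀) (hk : 0 < k) (hb : 0 < b) (hz₀ : 0 < z₀)
    (T : ℝ) (hT : T = 4 * Real.pi / b)
    (f : ℝ → ℝ) (hf : f = fun w => Real.exp (-2 * w ^ 2 / z₀ ^ 2)) :
    (∃ z : ℝ → ℝ,
      (∀ t ∈ Set.Icc 0 T, HasDerivWithinAt z (Fz F₀ k b f t (z t)) (Set.Icc 0 T) t) ∧
      z 0 = z T) ∧
    (∃ w : ℝ → ℝ, (∀ t : ℝ, w (t + T) = w t) ∧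
      ∀ t : ℝ, HasDerivAt w (Fz F₀ k b f t (w t)) t) := by
  subst hf
  have hTpos : 0 < T := by rw [hT]; positivity
  have hB := Fz_gaussian_bounded (a := z₀) b hF₀ hk hz₀
  set B := F₀ * (2 * k + 4 / z₀)
  have hBT : 0 ≤ B * T := by positivity
  obtain ⟨M, hM, hMz⟩ := exists_gaussian_threshold F₀ k b hz₀
  have hcosT : ∀ x, Real.cos (x - b * T / 2) = Real.cos (x - b * 0 / 2) := fun x => by
    simpa [hT] using cos_phase_sub_period hb.ne' x 0
  have hsmall : ∀ z, M ≤ |z| →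
      2 * k / b * (F₀ * Real.exp (-2 * z ^ 2 / z₀ ^ 2) * (2 * k + 4 * |z| / z₀ ^ 2)) < 1 := by
    intro z hz
    simpa using (hMz |z| hz).1
  have hex : ∃ z : ℝ → ℝ,
      (∀ t ∈ Set.Icc 0 T, HasDerivWithinAt z
        (Fz F₀ k b (fun w => Real.exp (-2 * w ^ 2 / z₀ ^ 2)) t (z t)) (Set.Icc 0 T) t) ∧
      z 0 = z T := by
    refine exists_solution_eq_boundary (M := M + B * T) hTpos (by positivity)
      (contDiff_Fz_gaussian F₀ k b z₀) hB (fun z hz hz0 => ?_) fun z hz hz0 => ?_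
    · have hstay : ∀ t ∈ Icc 0 T, M ≤ z t := fun t ht => by
        linarith [neg_le_of_abs_le (solution_displacement_le hB hz ht)]
      have hcorr := fun t ht => hasDerivWithinAt_corrected hb.ne' (hz t ht)
      have hanti := antitoneOn_of_hasDerivWithinAt_nonpos (convex_Icc 0 T)
        (fun t ht => (hcorr t ht).continuousWithinAt)
        (fun t ht => (hcorr t (interior_subset ht)).mono interior_subset) fun t ht => by
          have hMt := hstay t (interior_subset ht)
          have hzt : 0 < z t := hM.trans_le hMt
          refine mul_nonpos_of_nonneg_of_nonpos (by positivity) (sub_nonpos.2 ?_)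
          refine le_trans ?_ (hMz (z t) hMt).2
          refine mul_le_mul_of_nonneg_left (sq_le_sq' ?_ ?_) (by positivity)
          · have h1 := mul_le_mul_of_nonneg_left
              (Real.neg_one_le_sin (k * z t - b * t / 2)) (by positivity : 0 ≤ 2 * k)
            have h2 := mul_le_mul_of_nonneg_left
              (Real.neg_one_le_cos (k * z t - b * t / 2)) (by positivity : 0 ≤ 4 * z t / z₀ ^ 2)
            linarith
          · have h1 := mul_le_mul_of_nonneg_left
              (Real.sin_le_one (k * z t - b * t / 2)) (by positivity : 0 ≤ 2 * k)
            have h2 := mul_le_mul_of_nonneg_left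
              (Real.cos_le_one (k * z t - b * t / 2)) (by positivity : 0 ≤ 4 * z t / z₀ ^ 2)
            linarith
      have hle := hanti ⟨le_rfl, hTpos.le⟩ ⟨hTpos.le, le_rfl⟩ hTpos.le
      simp only [hcosT] at hle
      have hmono := strictMonoOn_corrected (a := z₀) hF₀ hk hb (convex_Ici M)
        (fun z hz => hsmall z (le_trans hz (le_abs_self z))) 0
      rw [← hz0]
      exact (hmono.le_iff_le (hstay T ⟨hTpos.le, le_rfl⟩) (hstay 0 ⟨le_rfl, hTpos.le⟩)).1 hle
    · have hstay : ∀ t ∈ Icc 0 T, z t ≤ -M := fun t ht => by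
        linarith [le_of_abs_le (solution_displacement_le hB hz ht)]
      have hcorr := fun t ht => hasDerivWithinAt_corrected hb.ne' (hz t ht)
      have hmon := monotoneOn_of_hasDerivWithinAt_nonneg (convex_Icc 0 T)
        (fun t ht => (hcorr t ht).continuousWithinAt)
        (fun t ht => (hcorr t (interior_subset ht)).mono interior_subset) fun t ht => by
          have hzt : z t ≤ 0 := by linarith [hstay t (interior_subset ht)]
          have hneg : 4 * z t / z₀ ^ 2 ≤ 0 :=
            div_nonpos_of_nonpos_of_nonneg (by linarith) (by positivity)
          exact mul_nonneg (by positivity) (sub_nonneg.2 (hneg.trans (by positivity)))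
      have hle := hmon ⟨le_rfl, hTpos.le⟩ ⟨hTpos.le, le_rfl⟩ hTpos.le
      simp only [hcosT] at hle
      have hmono := strictMonoOn_corrected (a := z₀) hF₀ hk hb (convex_Iic (-M))
        (fun z hz => hsmall z (le_abs.2 (Or.inr (le_neg.2 hz)))) 0
      rw [← hz0]
      exact (hmono.le_iff_le (hstay 0 ⟨le_rfl, hTpos.le⟩) (hstay T ⟨hTpos.le, le_rfl⟩)).1 hle
  refine ⟨hex, ?_⟩
  obtain ⟨z, hz, hzT⟩ := hex
  refine exists_periodic_extension_of_solution hTpos (fun x t => ?_) hz hzT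
  simp only [Fz_gaussian, hT, cos_phase_sub_period hb.ne', sin_phase_sub_period hb.ne']
end

section
/- Let f : ℝ → ℝ be C¹ with f(z) → 0 and f'(z) → 0 as |z| → ∞. Let (z_n) be a sequence of C¹ functions z_n : [0,T] → ℝ each satisfying z_n'(t) = F_z(t, z_n(t)) for all t ∈ [0,T], and suppose inf_{t ∈ [0,T]} |z_n(t)| → ∞ as n → ∞. Then sup_{t,s ∈ [0,T]} |z_n(t) − z_n(s)| → 0 as n → ∞. -/
open Filter Set

theorem abs_Fz_le {F₀ k : ℝ} (hF₀ : 0 ≤ F₀) (hk : 0 ≤ k) (b : ℝ) (f : ℝ → ℝ) (t z : ℝ) :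
    |Fz F₀ k b f t z| ≤ k * F₀ * |f z| + F₀ * |deriv f z| := by
  refine (abs_add_le _ _).trans (add_le_add ?_ ?_)
  · rw [abs_mul, abs_mul, abs_mul, abs_neg, abs_of_nonneg hk, abs_of_nonneg hF₀]
    exact mul_le_of_le_one_right (by positivity) (Real.abs_sin_le_one _)
  · rw [abs_mul, abs_mul, abs_of_nonneg hF₀, abs_of_nonneg (sq_nonneg _)]
    gcongr
    exact mul_le_of_le_one_right hF₀ (Real.cos_sq_le_one _)

theorem exists_forall_abs_Fz_le {F₀ k : ℝ} (hF₀ : 0 ≤ F₀) (hk : 0 ≤ k) (b : ℝ) {f : ℝ → ℝ}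
    (hf : Tendsto f (cocompact ℝ) (nhds 0)) (hf' : Tendsto (deriv f) (cocompact ℝ) (nhds 0))
    {δ : ℝ} (hδ : 0 < δ) : ∃ M : ℝ, ∀ t z : ℝ, M ≤ |z| → |Fz F₀ k b f t z| ≤ δ := by
  have hlim : Tendsto (fun z => k * F₀ * |f z| + F₀ * |deriv f z|) (cocompact ℝ) (nhds 0) := by
    simpa using (hf.abs.const_mul (k * F₀)).add (hf'.abs.const_mul F₀)
  have hev := hlim.eventually_le_const hδ
  rw [← Metric.cobounded_eq_cocompact, ← comap_norm_atTop, eventually_comap,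
    eventually_atTop] at hev
  obtain ⟨M, hM⟩ := hev
  exact ⟨M, fun t z hz => (abs_Fz_le hF₀ hk b f t z).trans (hM _ hz z rfl)⟩

/-- If `f, f' → 0` at infinity and `(z_n)` is a sequence of solutions of
`z' = F_z(t,z)` on `[0,T]` with `inf_{[0,T]} |z_n| → ∞`, then the oscillation
`sup_{t,s ∈ [0,T]} |z_n(t) − z_n(s)|` tends to `0`. -/
theorem oscillation_tendsto_zero
    (F₀ k b : ℝ) (hF₀ : 0 < F₀) (hk : 0 < k) (hb : 0 < b)
    (T : ℝ) (hT : T = 4 * Real.pi / b)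
    (f : ℝ → ℝ)
    (h1 : ContDiff ℝ 1 f)
    (h2 : Tendsto f (cocompact ℝ) (nhds 0))
    (h3 : Tendsto (deriv f) (cocompact ℝ) (nhds 0))
    (zseq : ℕ → ℝ → ℝ)
    (hsol : ∀ n, ∀ t ∈ Set.Icc 0 T,
      HasDerivWithinAt (zseq n) (Fz F₀ k b f t (zseq n t)) (Set.Icc 0 T) t)
    (hinf : ∀ M : ℝ, ∃ N : ℕ, ∀ n ≥ N, ∀ t ∈ Set.Icc 0 T, M ≤ |zseq n t|) :
    ∀ ε > 0, ∃ N : ℕ, ∀ n ≥ N, ∀ t ∈ Set.Icc 0 T, ∀ s ∈ Set.Icc 0 T,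
      |zseq n t - zseq n s| ≤ ε := by
  intro ε hε
  have hT0 : 0 < T := hT ▸ by positivity
  obtain ⟨M, hM⟩ := exists_forall_abs_Fz_le hF₀.le hk.le b h2 h3 (div_pos hε hT0)
  obtain ⟨N, hN⟩ := hinf M
  refine ⟨N, fun n hn t ht s hs => ?_⟩
  have hmv : |zseq n t - zseq n s| ≤ ε / T * |t - s| :=
    (convex_Icc 0 T).norm_image_sub_le_of_norm_hasDerivWithin_le (hsol n)
      (fun x hx => hM x _ (hN n hn x hx)) hs ht
  calc |zseq n t - zseq n s| ≤ ε / T * |t - s| := hmv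
    _ ≤ ε / T * T := by
      gcongr
      exact abs_le.mpr ⟨by linarith [ht.1, hs.2], by linarith [ht.2, hs.1]⟩
    _ = ε := div_mul_cancel₀ ε hT0.ne'
end
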